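/- For every integer n ≥ 1: if n is odd then m_{1,4}(n) = m_{3,4}(n), and if n is even then m_{1,4}(n) = m_{3,4}(n) + q(n/2), where m_{1,4}(n) and m_{3,4}(n) count partitions of n with mex congruent to 1, respectively 3, modulo 4, and q(m) is the number of partitions of m into distinct parts. -/

import Mathlib

/-- The mex of a partition: the smallest positive integer that is not a part. -/
noncomputable def partMex {n : ℕ} (P : Nat.Partition n) : ℕ :=
  sInf {k : ℕ | 0 < k ∧ k ∉ P.parts}

/-- `q m` is the number of partitions of `m` into distinct parts. -/
noncomputable def q (m : ℕ) : ℕ := Nat.card {P : Nat.Partition m // P.parts.Nodup}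

section Shanks

variable {R : Type*} [CommRing R]

/-- Shanks' finite form of Gauss' identity for the series with triangular exponents. Here `u i`
is the inverse of `1 - x ^ (2 * i + 1)`. -/
theorem sum_range_pow_triangular (x : R) (u : ℕ → R)
    (hu : ∀ i, (1 - x ^ (2 * i + 1)) * u i = 1) (n : ℕ) :
    ∑ s ∈ Finset.range (2 * n), x ^ (s * (s + 1) / 2) =
      ∑ s ∈ Finset.range n,
        (∏ i ∈ Finset.Ico s n, (1 - x ^ (2 * i + 2)) * u i) * x ^ (s * (2 * n + 1)) := by
  induction n with
  | zero => simp
  | succ n ih =>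
    have key : ∀ k ≤ n,
        ∑ s ∈ Finset.range k,
          ((∏ i ∈ Finset.Ico s (n + 1), (1 - x ^ (2 * i + 2)) * u i) * x ^ (s * (2 * (n + 1) + 1)) -
            (∏ i ∈ Finset.Ico s n, (1 - x ^ (2 * i + 2)) * u i) * x ^ (s * (2 * n + 1))) =
        (∏ i ∈ Finset.Ico k n, (1 - x ^ (2 * i + 2)) * u i) * (1 - x ^ (2 * k)) *
          x ^ (k * (2 * n + 1)) * u n := by
      intro k
      induction k with
      | zero => simp
      | succ k ihk =>
        intro hk
        rw [Finset.sum_range_succ, ihk (by omega), Finset.prod_Ico_succ_top (by omega : k ≤ n),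
          Finset.prod_eq_prod_Ico_succ_bot (by omega : k < n)]
        generalize ∏ i ∈ Finset.Ico (k + 1) n, (1 - x ^ (2 * i + 2)) * u i = g
        have h1 := hu n
        have h2 := hu k
        have e1 : x ^ (k * (2 * (n + 1) + 1)) = x ^ (k * (2 * n + 1)) * x ^ (2 * k) := by
          rw [← pow_add]; congr 1; ring
        have e2 : x ^ ((k + 1) * (2 * n + 1)) = x ^ (k * (2 * n + 1)) * x ^ (2 * n + 1) := by
          rw [← pow_add]; congr 1; ring
        have e3 : x ^ (2 * n + 2) = x ^ (2 * n + 1) * x := by rw [← pow_succ]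
        have e4 : x ^ (2 * k + 1) = x ^ (2 * k) * x := by rw [← pow_succ]
        have e5 : x ^ (2 * k + 2) = x ^ (2 * k) * x * x := by rw [← pow_succ, ← pow_succ]
        have e6 : x ^ (2 * (k + 1)) = x ^ (2 * k) * x * x := by rw [← e5]; rfl
        rw [e1, e2, e3, e5, e6]
        rw [e4] at h2
        generalize x ^ (2 * k) = a at *
        generalize x ^ (2 * n + 1) = b at *
        generalize x ^ (k * (2 * n + 1)) = c at *
        linear_combination (1 - a * x * x) * u k * g * c * h1 +
          (1 - a * x * x) * g * c * b * u n * h2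
    have hstep := key n le_rfl
    rw [Finset.sum_sub_distrib, ← ih, sub_eq_iff_eq_add] at hstep
    rw [Finset.sum_range_succ _ n, hstep, show 2 * (n + 1) = 2 * n + 1 + 1 by ring,
      Finset.sum_range_succ, Finset.sum_range_succ]
    have t1 : 2 * n * (2 * n + 1) / 2 = n * (2 * n + 1) := by
      rw [mul_assoc, Nat.mul_div_cancel_left _ two_pos]
    have t2 : (2 * n + 1) * (2 * n + 1 + 1) / 2 = n * (2 * n + 1) + (2 * n + 1) := by
      rw [show (2 * n + 1) * (2 * n + 1 + 1) = 2 * (n * (2 * n + 1) + (2 * n + 1)) by ring,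
        Nat.mul_div_cancel_left _ two_pos]
    have t3 : n * (2 * n + 1 + 1 + 1) = n * (2 * n + 1) + 2 * n := by ring
    have h1 := hu n
    rw [t1, t2, t3]
    simp only [Finset.Ico_self, Finset.prod_empty, Nat.Ico_succ_singleton, Finset.prod_singleton,
      pow_add _ (n * (2 * n + 1))]
    have e3 : x ^ (2 * n + 2) = x ^ (2 * n) * x * x := by rw [← pow_succ, ← pow_succ]
    have e4 : x ^ (2 * n + 1) = x ^ (2 * n) * x := by rw [← pow_succ]
    rw [e3]
    rw [e4] at h1 ⊢
    generalize x ^ (2 * n) = b at *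
    linear_combination (-(1 + b * x) * x ^ (n * (2 * n + 1))) * h1

end Shanks

section Congruences

open PowerSeries PowerSeries.WithPiTopology Finset

theorem dvd_prod_sub_one {R ι : Type*} [CommRing R] {d : R} {f : ι → R} (s : Finset ι)
    (h : ∀ i ∈ s, d ∣ f i - 1) : d ∣ ∏ i ∈ s, f i - 1 := by
  classical
  induction s using Finset.induction_on with
  | empty => simp
  | insert a s ha ih =>
    rw [prod_insert ha]
    have h1 := h a (mem_insert_self a s)
    have h2 := ih fun i hi ↦ h i (mem_insert_of_mem hi)
    convert (h1.mul_right (∏ i ∈ s, f i)).add h2 using 1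
    ring

/-- The generating function of partitions with parts satisfying `p` is inverse to the product of
the `1 - X ^ i` with `i ≤ N` satisfying `p`, up to order `N`. -/
theorem X_pow_dvd_restricted_mul_prod_sub_one (p : ℕ → Prop) [DecidablePred p] (N : ℕ) :
    (X : ℤ⟦X⟧) ^ (N + 1) ∣ PowerSeries.mk (fun n ↦ (#(Nat.Partition.restricted n p) : ℤ)) *
      (∏ i ∈ range N, if p (i + 1) then 1 - X ^ (i + 1) else 1) - 1 := by
  have hprod := Nat.Partition.hasProd_powerSeriesMk_card_restricted ℤ p
  set f : ℕ → ℤ⟦X⟧ := fun i ↦ if p (i + 1) then ∑' j : ℕ, X ^ ((i + 1) * j) else 1 with hf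
  set g : ℕ → ℤ⟦X⟧ := fun i ↦ if p (i + 1) then 1 - X ^ (i + 1) else 1 with hg
  have hfg (i : ℕ) : f i * g i = 1 := by
    simp only [hf, hg]
    split_ifs
    · simp_rw [pow_mul]
      exact tsum_pow_mul_one_sub_of_constantCoeff_eq_zero (by simp)
    · simp
  have hf1 (i : ℕ) : X ^ (i + 1) ∣ f i - 1 := by
    by_cases hp : p (i + 1)
    · refine ⟨f i, ?_⟩
      have h := hfg i
      simp only [hg, if_pos hp] at h
      linear_combination h
    · simp [hf, hp]
  rw [X_pow_dvd_iff]
  intro m hm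
  rw [map_sub, sub_eq_zero]
  have htend := ((continuous_coeff ℤ m).tendsto _).comp
    (Filter.Tendsto.mul_const (∏ i ∈ range N, g i) hprod)
  refine tendsto_nhds_unique htend (tendsto_atTop_of_eventually_const (i₀ := range N) fun s hs ↦ ?_)
  have hsplit : (∏ i ∈ s, f i) * ∏ i ∈ range N, g i = ∏ i ∈ s \ range N, f i := by
    rw [← prod_sdiff hs, mul_assoc, ← prod_mul_distrib, prod_congr rfl fun i _ ↦ hfg i,
      prod_const_one, mul_one]
  have hdvd : X ^ (N + 1) ∣ ∏ i ∈ s \ range N, f i - 1 :=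
    dvd_prod_sub_one _ fun i hi ↦ (pow_dvd_pow _ (by simp at hi; omega)).trans (hf1 i)
  have := X_pow_dvd_iff.1 hdvd m hm
  rw [map_sub, sub_eq_zero] at this
  simpa [hsplit] using this

end Congruences

section Mex

open Finset

theorem partMex_spec {n : ℕ} (P : Nat.Partition n) : 0 < partMex P ∧ partMex P ∉ P.parts := by
  have hne : {k : ℕ | 0 < k ∧ k ∉ P.parts}.Nonempty :=
    ⟨n + 1, n.succ_pos, fun h ↦ by have := Nat.Partition.le_of_mem_parts h; omega⟩
  exact Nat.sInf_mem hne

theorem partMex_le {n : ℕ} (P : Nat.Partition n) : partMex P ≤ n + 1 :=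
  Nat.sInf_le ⟨n.succ_pos, fun h ↦ by have := Nat.Partition.le_of_mem_parts h; omega⟩

theorem lt_partMex_iff {n : ℕ} (P : Nat.Partition n) (s : ℕ) :
    s < partMex P ↔ (Icc 1 s).val ≤ P.parts := by
  rw [Multiset.le_iff_subset (Icc 1 s).nodup]
  constructor
  · intro h k hk
    have hk' : 1 ≤ k ∧ k ≤ s := by simpa using hk
    by_contra hmem
    have : partMex P ≤ k := Nat.sInf_le ⟨hk'.1, hmem⟩
    omega
  · intro h
    by_contra! hle
    obtain ⟨h0, h1⟩ := partMex_spec P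
    exact h1 (h (by simpa using ⟨h0, hle⟩))

/-- Removing a given sub-multiset of parts. -/
def partitionContainingEquiv {n : ℕ} (M : Multiset ℕ) (hpos : ∀ i ∈ M, 0 < i) (hM : M.sum ≤ n) :
    {P : n.Partition // M ≤ P.parts} ≃ (n - M.sum).Partition where
  toFun P := ⟨P.1.parts - M, fun hi ↦ P.1.parts_pos (Multiset.mem_of_le tsub_le_self hi), by
    have h := congrArg Multiset.sum (tsub_add_cancel_of_le P.2)
    rw [Multiset.sum_add, P.1.parts_sum] at h
    omega⟩
  invFun Q := ⟨⟨Q.parts + M, fun hi ↦ (Multiset.mem_add.1 hi).elim Q.parts_pos (hpos _), by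
    rw [Multiset.sum_add, Q.parts_sum]
    omega⟩, Multiset.le_add_left _ _⟩
  left_inv P := Subtype.ext <| Nat.Partition.ext <| tsub_add_cancel_of_le P.2
  right_inv Q := Nat.Partition.ext <| add_tsub_cancel_right Q.parts M

theorem card_lt_partMex (n s : ℕ) :
    #{P : n.Partition | s < partMex P} =
      if s * (s + 1) / 2 ≤ n then Fintype.card (n - s * (s + 1) / 2).Partition else 0 := by
  have hsum : (Icc 1 s).val.sum = s * (s + 1) / 2 := by
    have h (t : ℕ) : (∑ i ∈ Icc 1 t, i) * 2 = t * (t + 1) := by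
      induction t with
      | zero => rfl
      | succ t ih =>
        rw [sum_Icc_succ_top (by omega), add_mul, ih]
        ring
    rw [← h s, Nat.mul_div_cancel _ two_pos]
    exact sum_val (Icc 1 s)
  simp_rw [lt_partMex_iff, ← hsum]
  split_ifs with h
  · rw [← Fintype.card_subtype]
    exact Fintype.card_congr (partitionContainingEquiv _ (fun i hi ↦ by
      have : 1 ≤ i ∧ i ≤ s := by simpa using hi
      omega) h)
  · rw [card_eq_zero, filter_eq_empty_iff]
    intro P _ hP
    obtain ⟨M, hM⟩ := Multiset.le_iff_exists_add.1 hP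
    have := congrArg Multiset.sum hM
    rw [Multiset.sum_add, P.parts_sum] at this
    omega

theorem sum_range_neg_one_pow_triangular (m : ℕ) :
    ∑ s ∈ range m, (-1 : ℤ) ^ (s * (s + 1) / 2) =
      (if m % 4 = 1 then 1 else 0) - (if m % 4 = 3 then 1 else 0) := by
  have hT (k r : ℕ) : (4 * k + r) * (4 * k + r + 1) / 2 =
      2 * (k * (4 * k + 2 * r + 1)) + r * (r + 1) / 2 := by
    rw [show (4 * k + r) * (4 * k + r + 1) =
      r * (r + 1) + 2 * (2 * (k * (4 * k + 2 * r + 1))) by ring,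
      Nat.add_mul_div_left _ _ two_pos, add_comm]
  induction m with
  | zero => simp
  | succ m ih =>
    rw [sum_range_succ, ih, ← Nat.div_add_mod m 4, hT, pow_add, pow_mul]
    have : m % 4 < 4 := Nat.mod_lt _ (by norm_num)
    generalize m / 4 = k
    interval_cases m % 4 <;> simp [Nat.add_mod]

theorem card_partMex_sub (n M : ℕ) (hM : n + 1 ≤ M) :
    (#{P : n.Partition | partMex P % 4 = 1} : ℤ) - #{P : n.Partition | partMex P % 4 = 3} =
      ∑ s ∈ range M, (-1 : ℤ) ^ (s * (s + 1) / 2) * #{P : n.Partition | s < partMex P} := by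
  simp_rw [card_filter, Nat.cast_sum, mul_sum]
  rw [sum_comm, ← sum_sub_distrib]
  refine sum_congr rfl fun P _ ↦ ?_
  have hP := partMex_le P
  have hfil : (range M).filter (· < partMex P) = range (partMex P) := by
    ext s
    simp only [mem_filter, mem_range]
    omega
  have h := sum_range_neg_one_pow_triangular (partMex P)
  rw [← hfil, sum_filter] at h
  push_cast
  simp_rw [mul_ite, mul_one, mul_zero]
  exact h.symm

end Mex

section Main

open PowerSeries Finset

theorem sum_card_lt_partMex_eq_coeff (n M : ℕ) :
    ∑ s ∈ range M, (-1 : ℤ) ^ (s * (s + 1) / 2) * #{P : n.Partition | s < partMex P} =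
      coeff n (PowerSeries.mk (fun n ↦ (#(Nat.Partition.restricted n fun _ ↦ True) : ℤ)) *
        ∑ s ∈ range M, (-X : ℤ⟦X⟧) ^ (s * (s + 1) / 2)) := by
  rw [mul_sum, map_sum]
  refine sum_congr rfl fun s _ ↦ ?_
  have hC : (-X : ℤ⟦X⟧) ^ (s * (s + 1) / 2) =
      C ((-1 : ℤ) ^ (s * (s + 1) / 2)) * X ^ (s * (s + 1) / 2) := by
    rw [neg_pow]; simp
  rw [hC, mul_left_comm, coeff_C_mul, coeff_mul_X_pow', card_lt_partMex]
  split_ifs <;> simp [Nat.Partition.restricted]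

/-- The generating function of `m_{1,4} - m_{3,4}` is that of partitions into odd parts, evaluated
at `X ^ 2`. -/
theorem X_pow_dvd_partitions_mul_triangular_sub (N : ℕ) (hN : N ≠ 0) :
    (X : ℤ⟦X⟧) ^ (2 * N + 1) ∣
      PowerSeries.mk (fun n ↦ (#(Nat.Partition.restricted n fun _ ↦ True) : ℤ)) *
        (∑ s ∈ range (2 * N), (-X : ℤ⟦X⟧) ^ (s * (s + 1) / 2)) -
      expand 2 two_ne_zero (PowerSeries.mk fun n ↦ (#(Nat.Partition.odds n) : ℤ)) := by
  have hunit (i : ℕ) : ∃ u : ℤ⟦X⟧, (1 - (-X) ^ (2 * i + 1)) * u = 1 := by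
    apply IsUnit.exists_right_inv
    rw [isUnit_iff_constantCoeff]
    simp
  choose u hu using hunit
  set P := PowerSeries.mk (fun n ↦ (#(Nat.Partition.restricted n fun _ ↦ True) : ℤ))
  set O := expand 2 two_ne_zero (PowerSeries.mk fun n ↦ (#(Nat.Partition.odds n) : ℤ))
  set G := ∏ i ∈ range N, (1 - (-X : ℤ⟦X⟧) ^ (2 * i + 2)) * u i
  set S := ∑ s ∈ range (2 * N), (-X : ℤ⟦X⟧) ^ (s * (s + 1) / 2) with hS
  set D := ∏ i ∈ range N, (1 - (X : ℤ⟦X⟧) ^ (2 * (2 * i + 1)))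
  have hSG : (X : ℤ⟦X⟧) ^ (2 * N + 1) ∣ S - G := by
    obtain ⟨k, rfl⟩ := Nat.exists_eq_succ_of_ne_zero hN
    rw [hS, sum_range_pow_triangular _ u hu, sum_range_succ']
    simp only [zero_mul, pow_zero, mul_one, ← Finset.range_eq_Ico]
    rw [add_sub_cancel_right]
    refine dvd_sum fun s _ ↦ Dvd.dvd.mul_left ?_ _
    rw [neg_pow]
    exact Dvd.dvd.mul_left (pow_dvd_pow _ (by nlinarith)) _
  have hGD : G * D = ∏ i ∈ range (2 * N), (1 - (X : ℤ⟦X⟧) ^ (i + 1)) := by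
    have h (n : ℕ) : (∏ i ∈ range n, (1 - (-X : ℤ⟦X⟧) ^ (2 * i + 2)) * u i) *
        ∏ i ∈ range n, (1 - (X : ℤ⟦X⟧) ^ (2 * (2 * i + 1))) =
        ∏ i ∈ range (2 * n), (1 - (X : ℤ⟦X⟧) ^ (i + 1)) := by
      induction n with
      | zero => simp
      | succ n ih =>
        rw [show 2 * (n + 1) = 2 * n + 1 + 1 by ring, prod_range_succ, prod_range_succ,
          prod_range_succ _ (2 * n + 1), prod_range_succ _ (2 * n), ← ih]
        have h1 := hu n
        have o : Odd (2 * n + 1) := ⟨n, rfl⟩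
        have e : Even (2 * n + 2) := ⟨n + 1, by ring⟩
        rw [o.neg_pow] at h1
        rw [e.neg_pow, mul_comm 2 (2 * n + 1), pow_mul]
        generalize ∏ i ∈ range n, (1 - (-X : ℤ⟦X⟧) ^ (2 * i + 2)) * u i = a
        generalize ∏ i ∈ range n, (1 - (X : ℤ⟦X⟧) ^ (2 * (2 * i + 1))) = b
        linear_combination a * b * (1 - X ^ (2 * n + 2)) * (1 - X ^ (2 * n + 1)) * h1
    exact h N
  have hP : (X : ℤ⟦X⟧) ^ (2 * N + 1) ∣ P * (G * D) - 1 := by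
    simpa [hGD] using X_pow_dvd_restricted_mul_prod_sub_one (fun _ ↦ True) (2 * N)
  have hOD : (X : ℤ⟦X⟧) ^ (2 * N + 1) ∣ O * D - 1 := by
    have h := map_dvd (expand 2 two_ne_zero)
      (X_pow_dvd_restricted_mul_prod_sub_one (¬ Even ·) (2 * N))
    have hodd (n : ℕ) : (∏ i ∈ range (2 * n),
        if ¬ Even (i + 1) then 1 - (X : ℤ⟦X⟧) ^ (i + 1) else 1) =
        ∏ i ∈ range n, (1 - (X : ℤ⟦X⟧) ^ (2 * i + 1)) := by
      induction n with
      | zero => simp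
      | succ n ih =>
        rw [show 2 * (n + 1) = 2 * n + 1 + 1 by ring, prod_range_succ, prod_range_succ, ih,
          prod_range_succ]
        simp [Nat.even_add_one]
    rw [hodd] at h
    simp only [map_sub, map_mul, map_pow, map_one, map_prod, expand_X, ← pow_mul] at h
    exact (pow_dvd_pow _ (by omega)).trans h
  have h := (hOD.mul_left (P * S)).neg_right |>.add
    ((hP.add (hSG.mul_left (P * D))).mul_left O)
  convert h using 1
  ring

theorem card_partMex_sub_eq (n : ℕ) :
    (#{P : n.Partition | partMex P % 4 = 1} : ℤ) - #{P : n.Partition | partMex P % 4 = 3} =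
      if 2 ∣ n then (#(Nat.Partition.distincts (n / 2)) : ℤ) else 0 := by
  rw [card_partMex_sub n (2 * (n + 1)) (by omega), sum_card_lt_partMex_eq_coeff]
  have h := X_pow_dvd_iff.1 (X_pow_dvd_partitions_mul_triangular_sub (n + 1) n.succ_ne_zero) n
    (by omega)
  rw [map_sub, sub_eq_zero] at h
  rw [h, coeff_expand, coeff_mk, Nat.Partition.card_odds_eq_card_distincts]

end Main

/-- For `n ≥ 1`: if `n` is odd then `m_{1,4}(n) = m_{3,4}(n)`, and if `n` is even then
`m_{1,4}(n) = m_{3,4}(n) + q(n/2)`. -/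
theorem stmt_10 (n : ℕ) (hn : 1 ≤ n) :
    (Odd n → Nat.card {P : Nat.Partition n // partMex P % 4 = 1} =
        Nat.card {P : Nat.Partition n // partMex P % 4 = 3}) ∧
    (Even n → Nat.card {P : Nat.Partition n // partMex P % 4 = 1} =
        Nat.card {P : Nat.Partition n // partMex P % 4 = 3} + q (n / 2)) := by
  have h := card_partMex_sub_eq n
  have hq : q (n / 2) = (Nat.Partition.distincts (n / 2)).card := by
    rw [q, Nat.card_eq_fintype_card, Fintype.card_subtype, Nat.Partition.distincts]
  rw [Nat.card_eq_fintype_card, Nat.card_eq_fintype_card, Fintype.card_subtype,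
    Fintype.card_subtype, hq]
  constructor
  · intro ho
    rw [if_neg (by rw [← even_iff_two_dvd]; simpa using ho)] at h
    omega
  · intro he
    rw [if_pos he.two_dvd] at h
    omega
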